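/- arXiv:2511.18971 — 2 statements merged into one kernel-verified Lean document; each statement's English description precedes it below -/
import Mathlib

section
/- For every real γ with γ₀ < γ ≤ √2, where γ₀ = 2·exp(−C_E) and C_E is the Euler–Mascheroni constant, one has K₀(γ)/K₁(γ) ≤ 1 − (γ₀ − 1)/γ. -/
open MeasureTheory Real

/-- Modified Bessel function of the second kind of integer order `j`, via the integral
representation `K_j(γ) = (2^j j! / (2j)!) · γ^{-j} · ∫_γ^∞ e^{-λ} (λ² - γ²)^{j - 1/2} dλ`. -/
noncomputable def besselK (j : ℕ) (γ : ℝ) : ℝ :=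
  ((2 : ℝ) ^ j * (Nat.factorial j) / (Nat.factorial (2 * j)) / γ ^ j) *
    ∫ l in Set.Ioi γ, Real.exp (-l) * (l ^ 2 - γ ^ 2) ^ ((j : ℝ) - 1 / 2)

/-- The ratio `h_i(γ) = K_i(γ)/K_{i+1}(γ)`. -/
noncomputable def hRatio (i : ℕ) (γ : ℝ) : ℝ := besselK i γ / besselK (i + 1) γ

open Set Filter Topology

lemma rpow_half_sq_sub_sq {γ l : ℝ} (hl : γ < l) :
    (l ^ 2 - γ ^ 2) ^ (1 / 2 : ℝ) = √(l - γ) * √(l + γ) := by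
  rw [← Real.sqrt_eq_rpow, ← Real.sqrt_mul (by linarith)]
  congr 1
  ring

lemma rpow_neg_half_sq_sub_sq {γ l : ℝ} (hγ : 0 < γ) (hl : γ < l) :
    (l ^ 2 - γ ^ 2) ^ (-(1 / 2) : ℝ) = 1 / (√(l - γ) * √(l + γ)) := by
  rw [Real.rpow_neg (by nlinarith), rpow_half_sq_sub_sq hl, one_div]

lemma besselK_zero_eq {γ : ℝ} (hγ : 0 < γ) :
    besselK 0 γ = ∫ l in Ioi γ, exp (-l) * (1 / (√(l - γ) * √(l + γ))) := by
  have h : besselK 0 γ = ∫ l in Ioi γ, exp (-l) * (l ^ 2 - γ ^ 2) ^ (-(1 / 2) : ℝ) := by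
    simp [besselK]
  rw [h]
  exact setIntegral_congr_fun measurableSet_Ioi fun l hl => by
    simp only [rpow_neg_half_sq_sub_sq hγ hl]

lemma besselK_one_eq (γ : ℝ) :
    besselK 1 γ = (∫ l in Ioi γ, exp (-l) * (√(l - γ) * √(l + γ))) / γ := by
  have h : besselK 1 γ = (∫ l in Ioi γ, exp (-l) * (l ^ 2 - γ ^ 2) ^ (1 / 2 : ℝ)) / γ := by
    have : ((1 : ℕ) : ℝ) - 1 / 2 = 1 / 2 := by norm_num
    rw [besselK, this]
    norm_num [Nat.factorial]
    ring
  rw [h]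
  congr 1
  exact setIntegral_congr_fun measurableSet_Ioi fun l hl => by
    simp only [rpow_half_sq_sub_sq hl]

lemma integrableOn_exp_neg_mul_sqrt_mul_sqrt {γ : ℝ} (hγ : 0 < γ) :
    IntegrableOn (fun l => exp (-l) * (√(l - γ) * √(l + γ))) (Ioi γ) := by
  have hG : IntegrableOn (fun l : ℝ => exp (-l) * l) (Ioi γ) := by
    have := (Real.GammaIntegral_convergent (s := 2) (by norm_num)).mono_set
      (Ioi_subset_Ioi hγ.le)
    refine this.congr_fun (fun l _ => ?_) measurableSet_Ioi
    norm_num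
  refine Integrable.mono' hG (by fun_prop) ?_
  filter_upwards [ae_restrict_mem measurableSet_Ioi] with l hl
  have hl' : γ < l := hl
  rw [Real.norm_of_nonneg (by positivity)]
  gcongr
  rw [← Real.sqrt_mul (by linarith)]
  exact Real.sqrt_le_iff.2 ⟨by linarith, by nlinarith [sq_nonneg γ]⟩

lemma integrableOn_exp_neg_mul_of_le_one {γ : ℝ} {f : ℝ → ℝ} (hf : Measurable f)
    (h0 : ∀ l, γ < l → 0 ≤ f l) (h1 : ∀ l, γ < l → f l ≤ 1) :
    IntegrableOn (fun l => exp (-l) * f l) (Ioi γ) := by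
  refine Integrable.mono' (integrableOn_exp_neg_Ioi γ) (by fun_prop) ?_
  filter_upwards [ae_restrict_mem measurableSet_Ioi] with l hl
  rw [Real.norm_of_nonneg (mul_nonneg (exp_pos _).le (h0 l hl))]
  exact mul_le_of_le_one_right (exp_pos _).le (h1 l hl)

lemma sqrt_sub_div_sqrt_add_le_one {γ l : ℝ} (hγ : 0 < γ) : √(l - γ) / √(l + γ) ≤ 1 :=
  div_le_one_of_le₀ (Real.sqrt_le_sqrt (by linarith)) (Real.sqrt_nonneg _)

lemma sqrt_sub_div_sqrt_add_pow_three_le {γ l : ℝ} (hγ : 1 < γ) (hl : γ < l) :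
    √(l - γ) / √(l + γ) ^ 3 ≤ √(l - γ) / √(l + γ) := by
  have hb : 1 ≤ √(l + γ) := Real.one_le_sqrt.2 (by linarith)
  gcongr
  exact le_self_pow₀ hb (by norm_num)

lemma hasDerivAt_exp_neg_mul_sqrt_combination {γ l : ℝ} (k c : ℝ) (hγ : 0 < γ) (hl : γ < l) :
    HasDerivAt (fun l => -(exp (-l) * (k * (√(l - γ) * √(l + γ)) + 2 * c * (√(l - γ) / √(l + γ)))))
      (k * (exp (-l) * (√(l - γ) * √(l + γ))) + (2 * c - k) * (exp (-l) * (√(l - γ) / √(l + γ)))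
        - (k * γ + c) * (exp (-l) * (1 / (√(l - γ) * √(l + γ))))
        + c * (exp (-l) * (√(l - γ) / √(l + γ) ^ 3))) l := by
  have ha : 0 < √(l - γ) := Real.sqrt_pos.2 (by linarith)
  have hb : 0 < √(l + γ) := Real.sqrt_pos.2 (by linarith)
  have ha2 : √(l - γ) ^ 2 = l - γ := Real.sq_sqrt (by linarith)
  have hb2 : √(l + γ) ^ 2 = l + γ := Real.sq_sqrt (by linarith)
  have hA : HasDerivAt (fun l => √(l - γ)) (1 / (2 * √(l - γ))) l :=
    ((hasDerivAt_id l).sub_const γ).sqrt (by simp only [id]; linarith)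
  have hB : HasDerivAt (fun l => √(l + γ)) (1 / (2 * √(l + γ))) l :=
    ((hasDerivAt_id l).add_const γ).sqrt (by simp only [id]; linarith)
  have hE : HasDerivAt (fun l : ℝ => exp (-l)) (exp (-l) * -1) l := (hasDerivAt_id l).neg.exp
  refine (hE.mul (((hA.mul hB).const_mul k).add
    ((hA.div hB hb.ne').const_mul (2 * c)))).neg.congr_deriv ?_
  simp only [Pi.mul_apply, Pi.div_apply, Pi.add_apply]
  generalize √(l - γ) = a at *
  generalize √(l + γ) = b at *
  have hg : γ = (b ^ 2 - a ^ 2) / 2 := by linarith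
  subst hg
  field_simp
  ring

lemma mul_integral_le_mul_integral {γ k c : ℝ} (hγ : 1 < γ) (hk : k * γ = γ - c) (hc : 0 ≤ c)
    (hkc : 3 * c ≤ k)
    (hW : IntegrableOn (fun l => exp (-l) * (1 / (√(l - γ) * √(l + γ)))) (Ioi γ)) :
    γ * ∫ l in Ioi γ, exp (-l) * (1 / (√(l - γ) * √(l + γ))) ≤
      k * ∫ l in Ioi γ, exp (-l) * (√(l - γ) * √(l + γ)) := by
  have hγ0 : 0 < γ := by linarith
  have hV := integrableOn_exp_neg_mul_sqrt_mul_sqrt hγ0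
  have hS : IntegrableOn (fun l => exp (-l) * (√(l - γ) / √(l + γ))) (Ioi γ) :=
    integrableOn_exp_neg_mul_of_le_one (by fun_prop) (fun l _ => by positivity)
      (fun l _ => sqrt_sub_div_sqrt_add_le_one hγ0)
  have hT : IntegrableOn (fun l => exp (-l) * (√(l - γ) / √(l + γ) ^ 3)) (Ioi γ) :=
    integrableOn_exp_neg_mul_of_le_one (by fun_prop) (fun l _ => by positivity)
      (fun l hl => (sqrt_sub_div_sqrt_add_pow_three_le hγ hl).trans
        (sqrt_sub_div_sqrt_add_le_one hγ0))
  have hD := (((hV.const_mul k).add (hS.const_mul (2 * c - k))).sub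
    (hW.const_mul (k * γ + c))).add (hT.const_mul c)
  have hlim : Tendsto (fun l => -(exp (-l) * (k * (√(l - γ) * √(l + γ))
      + 2 * c * (√(l - γ) / √(l + γ))))) atTop (𝓝 0) := by
    have hk0 : 0 ≤ k := by linarith
    have hup : Tendsto (fun l : ℝ => k * (l ^ 1 * exp (-l)) + 2 * c * (l ^ 0 * exp (-l)))
        atTop (𝓝 0) := by
      simpa using ((tendsto_pow_mul_exp_neg_atTop_nhds_zero 1).const_mul k).add
        ((tendsto_pow_mul_exp_neg_atTop_nhds_zero 0).const_mul (2 * c))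
    rw [← neg_zero]
    refine Tendsto.neg (squeeze_zero' ?_ ?_ hup)
    · exact Eventually.of_forall fun l => by positivity
    · filter_upwards [eventually_gt_atTop γ] with l hl
      have h1 : √(l - γ) * √(l + γ) ≤ l := by
        rw [← Real.sqrt_mul (by linarith)]
        exact Real.sqrt_le_iff.2 ⟨by linarith, by nlinarith [sq_nonneg γ]⟩
      have h2 : √(l - γ) / √(l + γ) ≤ 1 := sqrt_sub_div_sqrt_add_le_one hγ0
      calc _ ≤ exp (-l) * (k * l + 2 * c * 1) := by gcongr
        _ = _ := by ring
  have hcont : ContinuousWithinAt (fun l => -(exp (-l) * (k * (√(l - γ) * √(l + γ))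
      + 2 * c * (√(l - γ) / √(l + γ))))) (Ici γ) γ := by
    have hb : √(γ + γ) ≠ 0 := (Real.sqrt_pos.2 (by linarith)).ne'
    refine ContinuousAt.continuousWithinAt ?_
    fun_prop (disch := assumption)
  have hint := integral_Ioi_of_hasDerivAt_of_tendsto hcont
    (fun l hl => hasDerivAt_exp_neg_mul_sqrt_combination k c hγ0 hl) hD hlim
  simp only [sub_self, Real.sqrt_zero, zero_mul, zero_div, mul_zero, add_zero, neg_zero] at hint
  rw [← integral_const_mul, ← integral_const_mul, ← sub_nonneg,
    ← integral_sub (hV.const_mul k) (hW.const_mul γ), ← hint]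
  refine setIntegral_mono_on hD ((hV.const_mul k).sub (hW.const_mul γ)) measurableSet_Ioi ?_
  intro l hl
  have hle := sqrt_sub_div_sqrt_add_pow_three_le hγ hl
  have h0 : 0 ≤ √(l - γ) / √(l + γ) := by positivity
  have hE := exp_pos (-l)
  have hkey : 0 ≤ exp (-l) * ((k - 2 * c) * (√(l - γ) / √(l + γ))
      - c * (√(l - γ) / √(l + γ) ^ 3)) :=
    mul_nonneg hE.le (by nlinarith)
  have hkγ : k * γ + c = γ := by linarith
  simp only [hkγ]
  linarith

lemma one_lt_two_mul_exp_neg_eulerMascheroniConstant :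
    1 < 2 * exp (-eulerMascheroniConstant) := by
  have h : -log 2 < -eulerMascheroniConstant := by
    linarith [eulerMascheroniConstant_lt_two_thirds, Real.log_two_gt_d9]
  have := exp_lt_exp.2 h
  rw [exp_neg, exp_log (by norm_num)] at this
  linarith

lemma two_mul_exp_neg_eulerMascheroniConstant_lt :
    2 * exp (-eulerMascheroniConstant) < 5 / 4 := by
  have h := exp_lt_exp.2 (neg_lt_neg one_half_lt_eulerMascheroniConstant)
  have hq : 8 / 5 ≤ exp (1 / 2 : ℝ) := by
    linarith [Real.quadratic_le_exp_of_nonneg (x := 1 / 2) (by norm_num)]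
  have h' : exp (-(1 / 2) : ℝ) ≤ 5 / 8 := by
    rw [exp_neg]
    exact inv_le_of_inv_le₀ (by norm_num) (by norm_num at hq ⊢; exact hq)
  linarith

/-- For `γ₀ < γ ≤ √2` (with `γ₀ = 2 e^{-C_E}`), `K₀(γ)/K₁(γ) ≤ 1 − (γ₀−1)/γ`. -/
theorem bessel_ratio_upper_mid (γ : ℝ)
    (h1 : 2 * Real.exp (-Real.eulerMascheroniConstant) < γ) (h2 : γ ≤ Real.sqrt 2) :
    besselK 0 γ / besselK 1 γ ≤
      1 - (2 * Real.exp (-Real.eulerMascheroniConstant) - 1) / γ := by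
  have hlo := one_lt_two_mul_exp_neg_eulerMascheroniConstant
  have hhi := two_mul_exp_neg_eulerMascheroniConstant_lt
  generalize 2 * exp (-eulerMascheroniConstant) = γ₀ at *
  have hγ : 1 < γ := hlo.trans h1
  have hγ0 : 0 < γ := by linarith
  have hk : (1 - (γ₀ - 1) / γ) * γ = γ - (γ₀ - 1) := by field_simp
  have hdiv : (γ₀ - 1) / γ ≤ γ₀ - 1 := div_le_self (by linarith) hγ.le
  have hk0 : 0 ≤ 1 - (γ₀ - 1) / γ := by linarith
  rw [besselK_zero_eq hγ0, besselK_one_eq γ]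
  have hV : 0 ≤ ∫ l in Ioi γ, exp (-l) * (√(l - γ) * √(l + γ)) :=
    integral_nonneg fun l => by positivity
  by_cases hW : IntegrableOn (fun l => exp (-l) * (1 / (√(l - γ) * √(l + γ)))) (Ioi γ)
  · refine div_le_of_le_mul₀ (by positivity) hk0 ?_
    rw [mul_div_assoc', le_div_iff₀ hγ0, mul_comm]
    exact mul_integral_le_mul_integral hγ hk (by linarith) (by linarith) hW
  · rw [integral_undef hW, zero_div]
    exact hk0
end

section
/- For every real γ > √2, one has 1 − 1/(2γ) ≤ K₀(γ)/K₁(γ) ≤ 1 − 1/(2γ) + 3/(8γ²) + 3/(16γ³). -/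
open MeasureTheory Real

/-- The weight `e^{-l} / √(l² - γ²)` against which both Bessel integrals are moments. -/
noncomputable def besselWeight (γ l : ℝ) : ℝ := exp (-l) / √(l ^ 2 - γ ^ 2)

lemma besselWeight_nonneg (γ l : ℝ) : 0 ≤ besselWeight γ l := by
  unfold besselWeight; positivity

lemma measurable_besselWeight (γ : ℝ) : Measurable (besselWeight γ) := by
  unfold besselWeight; fun_prop

lemma sq_sub_sq_pos_of_lt {γ l : ℝ} (hγ : 0 < γ) (hl : γ < l) : 0 < l ^ 2 - γ ^ 2 := by
  nlinarith

lemma integrableOn_exp_mul_sub_rpow (γ : ℝ) {s : ℝ} (hs : 0 < s) :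
    IntegrableOn (fun l => exp (-l) * (l - γ) ^ (s - 1)) (Set.Ioi γ) := by
  have hset : (fun x : ℝ => x - γ) ⁻¹' Set.Ioi 0 = Set.Ioi γ := by ext; simp
  have h := ((measurePreserving_sub_right volume γ).integrableOn_comp_preimage
    (MeasurableEquiv.subRight γ).measurableEmbedding).2 (GammaIntegral_convergent hs)
  rw [hset] at h
  refine (h.const_mul (exp (-γ))).congr (ae_of_all _ fun l => ?_)
  simp only [Function.comp_apply, ← mul_assoc, ← exp_add]
  congr 2
  ring

lemma integrableOn_besselWeight {γ : ℝ} (hγ : 0 < γ) :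
    IntegrableOn (besselWeight γ) (Set.Ioi γ) := by
  have h := (integrableOn_exp_mul_sub_rpow γ (s := 1 / 2) (by norm_num)).const_mul (√(2 * γ))⁻¹
  refine h.mono' (measurable_besselWeight γ).aestronglyMeasurable ?_
  refine (ae_restrict_mem measurableSet_Ioi).mono fun l (hl : γ < l) => ?_
  have hpos : 0 < l - γ := sub_pos.2 hl
  rw [norm_of_nonneg (besselWeight_nonneg γ l), besselWeight]
  have hrpow : (l - γ) ^ ((1 / 2 : ℝ) - 1) = (√(l - γ))⁻¹ := by
    rw [sqrt_eq_rpow, ← rpow_neg hpos.le]; norm_num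
  have hle : √(2 * γ) * √(l - γ) ≤ √(l ^ 2 - γ ^ 2) := by
    rw [← sqrt_mul (by positivity)]
    exact sqrt_le_sqrt (by nlinarith)
  rw [hrpow]
  calc exp (-l) / √(l ^ 2 - γ ^ 2) ≤ exp (-l) / (√(2 * γ) * √(l - γ)) := by gcongr
    _ = _ := by field_simp

lemma integrableOn_mul_besselWeight {γ : ℝ} (hγ : 0 < γ) :
    IntegrableOn (fun l => l * besselWeight γ l) (Set.Ioi γ) := by
  have h := ((integrableOn_exp_mul_sub_rpow γ (s := 3 / 2) (by norm_num)).const_mul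
    (√(2 * γ))⁻¹).add ((integrableOn_besselWeight hγ).const_mul γ)
  refine h.mono' (measurable_id.mul (measurable_besselWeight γ)).aestronglyMeasurable ?_
  refine (ae_restrict_mem measurableSet_Ioi).mono fun l (hl : γ < l) => ?_
  have hpos : 0 < l - γ := sub_pos.2 hl
  have hl0 : 0 < l := hγ.trans hl
  rw [norm_of_nonneg (mul_nonneg hl0.le (besselWeight_nonneg γ l))]
  have hrpow : (l - γ) ^ ((3 / 2 : ℝ) - 1) = √(l - γ) := by
    rw [sqrt_eq_rpow]; norm_num
  have hle : √(2 * γ) * √(l - γ) ≤ √(l ^ 2 - γ ^ 2) := by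
    rw [← sqrt_mul (by positivity)]
    exact sqrt_le_sqrt (by nlinarith)
  simp only [Pi.add_apply, hrpow]
  suffices (l - γ) * besselWeight γ l ≤ (√(2 * γ))⁻¹ * (exp (-l) * √(l - γ)) by linarith
  calc (l - γ) * besselWeight γ l
      ≤ (l - γ) * (exp (-l) / (√(2 * γ) * √(l - γ))) := by unfold besselWeight; gcongr
    _ = (√(l - γ) * √(l - γ)) * (exp (-l) / (√(2 * γ) * √(l - γ))) := by
        rw [mul_self_sqrt hpos.le]
    _ = _ := by
        have := sqrt_pos.2 hpos
        field_simp

/-- Integration by parts against the Bessel weight: the total derivative of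
`p(l) e^{-l} √(l² - γ²)` integrates to zero over `(γ, ∞)`. -/
lemma integral_besselWeight_mul_eq_zero {γ C : ℝ} (hγ : 0 < γ) {p p' : ℝ → ℝ}
    (hp : ∀ l ∈ Set.Ici γ, HasDerivAt p (p' l) l) (hC : ∀ l ∈ Set.Ici γ, |p l| ≤ C)
    (h_integral : IntegrableOn
      (fun l => besselWeight γ l * ((p' l - p l) * (l ^ 2 - γ ^ 2) + p l * l)) (Set.Ioi γ)) :
    ∫ l in Set.Ioi γ, besselWeight γ l * ((p' l - p l) * (l ^ 2 - γ ^ 2) + p l * l) = 0 := by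
  have hcont : ContinuousWithinAt (fun l => p l * (exp (-l) * √(l ^ 2 - γ ^ 2))) (Set.Ici γ) γ := by
    have h1 : ContinuousAt p γ := (hp γ Set.self_mem_Ici).continuousAt
    have h2 : Continuous fun l : ℝ => exp (-l) * √(l ^ 2 - γ ^ 2) := by fun_prop
    exact (h1.mul h2.continuousAt).continuousWithinAt
  have hderiv : ∀ l ∈ Set.Ioi γ, HasDerivAt (fun l => p l * (exp (-l) * √(l ^ 2 - γ ^ 2)))
      (besselWeight γ l * ((p' l - p l) * (l ^ 2 - γ ^ 2) + p l * l)) l := by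
    intro l hl
    have hpos := sq_sub_sq_pos_of_lt hγ hl
    have hs := (((hasDerivAt_id l).pow 2).sub_const (γ ^ 2)).sqrt hpos.ne'
    have he := (hasDerivAt_id l).neg.exp
    refine ((hp l (Set.Ioi_subset_Ici_self hl)).mul (he.mul hs)).congr_deriv ?_
    have hsp := sqrt_pos.2 hpos
    have hsq := sq_sqrt hpos.le
    simp only [besselWeight, id, Pi.neg_apply, Pi.pow_apply, Pi.mul_apply]
    field_simp
    rw [hsq]
    push_cast
    ring
  have hlim : Filter.Tendsto (fun l => p l * (exp (-l) * √(l ^ 2 - γ ^ 2))) Filter.atTop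
      (nhds 0) := by
    have h0 : Filter.Tendsto (fun l : ℝ => C * (l ^ 1 * exp (-l))) Filter.atTop (nhds 0) := by
      simpa using (tendsto_pow_mul_exp_neg_atTop_nhds_zero 1).const_mul C
    refine squeeze_zero_norm' ?_ h0
    filter_upwards [Filter.eventually_ge_atTop γ] with l hl
    have hl0 : 0 < l := hγ.trans_le hl
    have hs : √(l ^ 2 - γ ^ 2) ≤ l := by
      rw [sqrt_le_left hl0.le]; nlinarith
    have hC0 : 0 ≤ C := (abs_nonneg _).trans (hC l hl)
    rw [norm_mul, norm_of_nonneg (by positivity : 0 ≤ exp (-l) * √(l ^ 2 - γ ^ 2)), norm_eq_abs,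
      pow_one, mul_comm l]
    gcongr
    exact hC l hl
  rw [integral_Ioi_of_hasDerivAt_of_tendsto hcont hderiv h_integral hlim]
  simp

/-- `e^{-l} √(l² - γ²)` is integrable on `(γ, ∞)`. -/
lemma integrableOn_besselWeight_mul_sq_sub_sq {γ : ℝ} (hγ : 0 < γ) :
    IntegrableOn (fun l => besselWeight γ l * (l ^ 2 - γ ^ 2)) (Set.Ioi γ) := by
  have h := (integrableOn_exp_mul_sub_rpow γ (s := 2) (by norm_num)).add
    ((integrableOn_exp_mul_sub_rpow γ (s := 1) (by norm_num)).const_mul γ)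
  refine h.mono' ((measurable_besselWeight γ).mul (by fun_prop)).aestronglyMeasurable ?_
  refine (ae_restrict_mem measurableSet_Ioi).mono fun l (hl : γ < l) => ?_
  have hpos := sq_sub_sq_pos_of_lt hγ hl
  have hs : √(l ^ 2 - γ ^ 2) ≤ l := by
    rw [sqrt_le_left (hγ.trans hl).le]; nlinarith
  rw [norm_of_nonneg (mul_nonneg (besselWeight_nonneg γ l) hpos.le), besselWeight,
    div_mul_eq_mul_div, mul_div_assoc, div_sqrt]
  norm_num
  nlinarith [exp_pos (-l)]

lemma integral_besselWeight_mul_sq_sub_sq {γ : ℝ} (hγ : 0 < γ) :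
    ∫ l in Set.Ioi γ, besselWeight γ l * (l ^ 2 - γ ^ 2) =
      ∫ l in Set.Ioi γ, l * besselWeight γ l := by
  have hJ := integrableOn_besselWeight_mul_sq_sub_sq hγ
  have hl := integrableOn_mul_besselWeight hγ
  have heq : (fun l => besselWeight γ l * ((0 - 1) * (l ^ 2 - γ ^ 2) + 1 * l)) =
      fun l => l * besselWeight γ l - besselWeight γ l * (l ^ 2 - γ ^ 2) := by
    ext; ring
  have h := integral_besselWeight_mul_eq_zero (C := 1) hγ (p := fun _ => 1) (p' := fun _ => 0)
    (fun l _ => hasDerivAt_const l 1) (by simp) (by rw [heq]; exact hl.sub hJ)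
  rw [heq, integral_sub hl hJ] at h
  linarith

lemma abs_div_add_sub_sub_le {γ l : ℝ} (hγ : 0 < γ) (hl : γ < l) :
    |γ / (l + γ) - (l - γ)| ≤ 1 + l := by
  have h0 : 0 ≤ γ / (l + γ) := div_nonneg hγ.le (by linarith)
  have h1 : γ / (l + γ) ≤ 1 := (div_le_one (by linarith)).2 (by linarith)
  rw [abs_le]
  constructor <;> linarith

lemma integrableOn_besselWeight_mul_div {γ : ℝ} (hγ : 0 < γ) :
    IntegrableOn (fun l => besselWeight γ l * (γ / (l + γ) - (l - γ))) (Set.Ioi γ) := by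
  refine ((integrableOn_besselWeight hγ).add (integrableOn_mul_besselWeight hγ)).mono'
    ((measurable_besselWeight γ).mul (by fun_prop)).aestronglyMeasurable ?_
  refine (ae_restrict_mem measurableSet_Ioi).mono fun l (hl : γ < l) => ?_
  have hw := besselWeight_nonneg γ l
  rw [norm_mul, norm_of_nonneg hw, norm_eq_abs]
  calc _ ≤ besselWeight γ l * (1 + l) := by gcongr; exact abs_div_add_sub_sub_le hγ hl
    _ = _ := by simp only [Pi.add_apply]; ring

lemma integral_besselWeight_mul_div_eq_zero {γ : ℝ} (hγ : 0 < γ) :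
    ∫ l in Set.Ioi γ, besselWeight γ l * (γ / (l + γ) - (l - γ)) = 0 := by
  have heq : Set.EqOn (fun l => besselWeight γ l * (γ / (l + γ) - (l - γ)))
      (fun l => besselWeight γ l *
        ((-1 / (l + γ) ^ 2 - 1 / (l + γ)) * (l ^ 2 - γ ^ 2) + 1 / (l + γ) * l)) (Set.Ioi γ) := by
    intro l (hl : γ < l)
    have : l + γ ≠ 0 := by linarith
    simp only
    congr 1
    field_simp
    ring
  rw [setIntegral_congr_fun measurableSet_Ioi heq]
  refine integral_besselWeight_mul_eq_zero (C := 1 / γ) hγ (p := fun l => 1 / (l + γ))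
    (p' := fun l => -1 / (l + γ) ^ 2) ?_ ?_
    ((integrableOn_besselWeight_mul_div hγ).congr_fun heq measurableSet_Ioi)
  · intro l (hl : γ ≤ l)
    simpa using ((hasDerivAt_id l).add_const γ).fun_inv (by simp only [id]; linarith)
  · intro l (hl : γ ≤ l)
    have : 0 < l + γ := by linarith
    rw [abs_of_pos (by positivity)]
    gcongr
    linarith

/-- A linear function of `l` that dominates a multiple of a null function of the weight has
nonnegative integral. -/
lemma le_of_forall_mul_le {γ a b c : ℝ} (hγ : 0 < γ)
    (h : ∀ l, γ < l → c * (γ / (l + γ) - (l - γ)) ≤ a - b * l) :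
    b * ∫ l in Set.Ioi γ, l * besselWeight γ l ≤ a * ∫ l in Set.Ioi γ, besselWeight γ l := by
  have h0 := (integrableOn_besselWeight hγ).const_mul a
  have h1 := (integrableOn_mul_besselWeight hγ).const_mul b
  have hmono := setIntegral_mono_on ((integrableOn_besselWeight_mul_div hγ).const_mul c)
    (h0.sub h1) measurableSet_Ioi fun l (hl : γ < l) => by
      have := mul_le_mul_of_nonneg_left (h l hl) (besselWeight_nonneg γ l)
      simp only [Pi.sub_apply]
      linarith
  simp only [Pi.sub_apply] at hmono
  rw [integral_const_mul, integral_besselWeight_mul_div_eq_zero hγ, integral_sub h0 h1,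
    integral_const_mul, integral_const_mul] at hmono
  linarith

lemma integral_mul_besselWeight_pos {γ : ℝ} (hγ : 0 < γ) :
    0 < ∫ l in Set.Ioi γ, l * besselWeight γ l := by
  have hpos : ∀ l ∈ Set.Ioi γ, 0 < l * besselWeight γ l := fun l hl => by
    have := sqrt_pos.2 (sq_sub_sq_pos_of_lt hγ hl)
    have : 0 < l := hγ.trans hl
    unfold besselWeight
    positivity
  rw [setIntegral_pos_iff_support_of_nonneg_ae
    ((ae_restrict_mem measurableSet_Ioi).mono fun l hl => (hpos l hl).le)
    (integrableOn_mul_besselWeight hγ),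
    Set.inter_eq_right.2 fun l hl => Function.mem_support.2 (hpos l hl).ne']
  simp

lemma besselK_zero {γ : ℝ} (hγ : 0 < γ) :
    besselK 0 γ = ∫ l in Set.Ioi γ, besselWeight γ l := by
  simp only [besselK, pow_zero, Nat.factorial_zero, mul_zero, Nat.cast_one, Nat.cast_zero,
    mul_one, div_one, one_mul]
  refine setIntegral_congr_fun measurableSet_Ioi fun l hl => ?_
  simp only [besselWeight]
  rw [sqrt_eq_rpow, zero_sub, rpow_neg (sq_sub_sq_pos_of_lt hγ hl).le, ← div_eq_mul_inv]

lemma besselK_one {γ : ℝ} (hγ : 0 < γ) :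
    besselK 1 γ = (∫ l in Set.Ioi γ, l * besselWeight γ l) / γ := by
  rw [← integral_besselWeight_mul_sq_sub_sq hγ]
  have h_integral : ∫ l in Set.Ioi γ, exp (-l) * (l ^ 2 - γ ^ 2) ^ (((1 : ℕ) : ℝ) - 1 / 2) =
      ∫ l in Set.Ioi γ, besselWeight γ l * (l ^ 2 - γ ^ 2) := by
    refine setIntegral_congr_fun measurableSet_Ioi fun l hl => ?_
    simp only [besselWeight]
    rw [div_mul_eq_mul_div, mul_div_assoc, div_sqrt, sqrt_eq_rpow]
    norm_num
  rw [besselK, h_integral]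
  norm_num
  ring

/-- For `γ > √2`, `1 − 1/(2γ) ≤ K₀(γ)/K₁(γ) ≤ 1 − 1/(2γ) + 3/(8γ²) + 3/(16γ³)`. -/
theorem bessel_ratio_bounds_large (γ : ℝ) (hγ : Real.sqrt 2 < γ) :
    1 - 1 / (2 * γ) ≤ besselK 0 γ / besselK 1 γ ∧
    besselK 0 γ / besselK 1 γ ≤
      1 - 1 / (2 * γ) + 3 / (8 * γ ^ 2) + 3 / (16 * γ ^ 3) := by
  have h0 : 0 < γ := (sqrt_nonneg 2).trans_lt hγ
  have hJ := integral_mul_besselWeight_pos h0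
  rw [besselK_zero h0, besselK_one h0, div_div_eq_mul_div, le_div_iff₀ hJ, div_le_iff₀ hJ,
    mul_comm (∫ l in Set.Ioi γ, besselWeight γ l) γ]
  constructor
  · refine le_of_forall_mul_le (c := 1) h0 fun l hl => ?_
    have hlγ : 0 < l + γ := by linarith
    have key : γ - (1 - 1 / (2 * γ)) * l - 1 * (γ / (l + γ) - (l - γ)) =
        (l - γ) / (2 * γ) + (l - γ) / (2 * (l + γ)) := by
      field_simp
      ring
    have hd : 0 < l - γ := sub_pos.2 hl
    have : 0 ≤ (l - γ) / (2 * γ) + (l - γ) / (2 * (l + γ)) := by positivity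
    linarith
  · have := le_of_forall_mul_le (a := -γ)
      (b := -(1 - 1 / (2 * γ) + 3 / (8 * γ ^ 2) + 3 / (16 * γ ^ 3)))
      (c := -(1 - 3 / (4 * γ) - 3 / (8 * γ ^ 2))) h0 fun l hl => by
        have hlγ : 0 < l + γ := by linarith
        have hd : 0 < l - γ := sub_pos.2 hl
        have key : -γ - -(1 - 1 / (2 * γ) + 3 / (8 * γ ^ 2) + 3 / (16 * γ ^ 3)) * l -
            -(1 - 3 / (4 * γ) - 3 / (8 * γ ^ 2)) * (γ / (l + γ) - (l - γ)) =
            ((l - γ) * (15 / (8 * γ) + 9 / (16 * γ ^ 2)) +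
              (l - γ) ^ 2 * (1 / (4 * γ) + 3 / (4 * γ ^ 2) + 3 / (16 * γ ^ 3))) / (l + γ) := by
          field_simp
          ring
        have : 0 ≤ ((l - γ) * (15 / (8 * γ) + 9 / (16 * γ ^ 2)) +
            (l - γ) ^ 2 * (1 / (4 * γ) + 3 / (4 * γ ^ 2) + 3 / (16 * γ ^ 3))) / (l + γ) := by
          positivity
        linarith
    linarith
end
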